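/- arXiv:1410.3418 — 2 statements merged into one kernel-verified Lean document; each statement's English description precedes it below -/
import Mathlib

section
/- At every point of U the identity 1 − (D · JC)^2 = Σ_{i,j=1}^{2N} g^{ij} w_i w_j holds. (Lemma 2.2(b).) -/
open scoped RealInnerProductSpace BigOperators

/-- Partial derivative of `f` in the `i`-th coordinate direction. -/
noncomputable def pd {ι : Type*} [Fintype ι] [DecidableEq ι]
    {F : Type*} [NormedAddCommGroup F] [NormedSpace ℝ F]
    (i : ι) (f : EuclideanSpace ℝ ι → F) (u : EuclideanSpace ℝ ι) : F :=
  fderiv ℝ f u (EuclideanSpace.single i 1)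

/-- Euclidean dot product on `ℝ^m × ℝ^m ≅ ℝ^{2m}`. -/
noncomputable def dot {m : ℕ} (p q : EuclideanSpace ℝ (Fin m) × EuclideanSpace ℝ (Fin m)) : ℝ :=
  @inner ℝ _ _ p.1 q.1 + @inner ℝ _ _ p.2 q.2

/-- The complex structure `J(x, y) = (−y, x)` on `ℝ^m × ℝ^m ≅ ℂ^m`. -/
def Jmap {m : ℕ} (p : EuclideanSpace ℝ (Fin m) × EuclideanSpace ℝ (Fin m)) :
    EuclideanSpace ℝ (Fin m) × EuclideanSpace ℝ (Fin m) :=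
  (-p.2, p.1)

/-- The Pythagorean identity for a family `e` with invertible Gram matrix together with orthonormal
vectors `c`, `d` orthogonal to it, in a space of dimension `card ι + 2`. -/
theorem inner_self_eq_of_gram_isUnit {ι E : Type*} [Fintype ι] [DecidableEq ι]
    [NormedAddCommGroup E] [InnerProductSpace ℝ E] [FiniteDimensional ℝ E]
    (hfin : Module.finrank ℝ E = Fintype.card ι + 2) (e : ι → E) (c d : E)
    (G : Matrix ι ι ℝ) (hG : ∀ i j, G i j = ⟪e i, e j⟫) (hdet : IsUnit G.det)
    (hcc : ⟪c, c⟫ = 1) (hdd : ⟪d, d⟫ = 1) (hcd : ⟪c, d⟫ = 0)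
    (hce : ∀ i, ⟪c, e i⟫ = 0) (hde : ∀ i, ⟪d, e i⟫ = 0) (v : E) :
    ⟪v, v⟫ = ⟪c, v⟫ ^ 2 + ⟪d, v⟫ ^ 2 +
      ∑ i, ∑ j, G⁻¹ i j * ⟪e i, v⟫ * ⟪e j, v⟫ := by
  have hdc : ⟪d, c⟫ = 0 := by rw [real_inner_comm, hcd]
  have hec (i) : ⟪e i, c⟫ = 0 := by rw [real_inner_comm, hce]
  have hed (i) : ⟪e i, d⟫ = 0 := by rw [real_inner_comm, hde]
  have hcn : ‖c‖ ^ 2 = 1 := by rw [← real_inner_self_eq_norm_sq, hcc]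
  have hdn : ‖d‖ ^ 2 = 1 := by rw [← real_inner_self_eq_norm_sq, hdd]
  let T : E →ₗ[ℝ] (ι → ℝ) × ℝ × ℝ :=
    (LinearMap.pi fun i => innerₛₗ ℝ (e i)).prod ((innerₛₗ ℝ c).prod (innerₛₗ ℝ d))
  let S : (ι → ℝ) × ℝ × ℝ → E := fun p =>
    ∑ i, (G⁻¹.mulVec p.1) i • e i + p.2.1 • c + p.2.2 • d
  have hTS (p) : T (S p) = p := by
    obtain ⟨y, a, b⟩ := p
    refine Prod.ext (funext fun k => ?_) (Prod.ext ?_ ?_)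
    · have h : G.mulVec (G⁻¹.mulVec y) k = y k := by
        rw [Matrix.mulVec_mulVec, Matrix.mul_nonsing_inv _ hdet, Matrix.one_mulVec]
      refine Eq.trans ?_ h
      simp [T, S, inner_add_right, inner_sum, inner_smul_right, hec, hed, Matrix.mulVec,
        dotProduct, hG, mul_comm]
    · simp [T, S, inner_add_right, inner_sum, inner_smul_right, hce, hcd, hcn]
    · simp [T, S, inner_add_right, inner_sum, inner_smul_right, hde, hdc, hdn]
  have hinj : Function.Injective T := by
    refine (LinearMap.injective_iff_surjective_of_finrank_eq_finrank ?_).2 fun p => ⟨S p, hTS p⟩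
    simp [hfin]
  have hv : S (T v) = v := hinj (hTS _)
  calc ⟪v, v⟫ = ⟪S (T v), v⟫ := by rw [hv]
    _ = _ := by
      simp only [S, T, inner_add_left, sum_inner, real_inner_smul_left, Matrix.mulVec, dotProduct,
        Finset.sum_mul, LinearMap.prod_apply, Function.prod, LinearMap.pi_apply, innerₛₗ_apply_apply]
      rw [add_assoc, add_comm, sq, sq]
      congr 1
      exact Finset.sum_congr rfl fun i _ => Finset.sum_congr rfl fun j _ => by ring

theorem inner_pd_eq_zero_of_norm_eq_one {ι F : Type*} [Fintype ι] [DecidableEq ι]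
    [NormedAddCommGroup F] [InnerProductSpace ℝ F] {f : EuclideanSpace ℝ ι → F}
    (hf : Differentiable ℝ f) (hnorm : ∀ u, ‖f u‖ = 1) (i : ι) (u : EuclideanSpace ℝ ι) :
    ⟪f u, pd i f u⟫ = 0 := by
  have h := fderiv_inner_apply ℝ (hf u) (hf u) (EuclideanSpace.single i 1)
  have hconst : (fun x => ⟪f x, f x⟫) = fun _ => (1 : ℝ) := by
    funext x
    simp [hnorm]
  rw [hconst, real_inner_comm (f u)] at h
  simp only [fderiv_fun_const, Pi.zero_apply, zero_apply] at h
  change ⟪f u, fderiv ℝ f u (EuclideanSpace.single i 1)⟫ = 0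
  rw [real_inner_comm] at h ⊢
  linarith

/-- Lemma 2.2(b). -/
theorem clifford_torus_tangential_norm_identity (N : ℕ) (hN : 1 ≤ N)
    (X Y : EuclideanSpace ℝ (Fin (2 * N)) → EuclideanSpace ℝ (Fin (N + 1)))
    (hX : ContDiff ℝ (⊤ : ℕ∞) X) (hY : ContDiff ℝ (⊤ : ℕ∞) Y)
    (hXdep : ∀ u u' : EuclideanSpace ℝ (Fin (2 * N)),
      (∀ i : Fin (2 * N), (i : ℕ) < N → u i = u' i) → X u = X u')
    (hYdep : ∀ u u' : EuclideanSpace ℝ (Fin (2 * N)),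
      (∀ i : Fin (2 * N), N ≤ (i : ℕ) → u i = u' i) → Y u = Y u')
    (hXnorm : ∀ u, ‖X u‖ = 1) (hYnorm : ∀ u, ‖Y u‖ = 1)
    (C D : EuclideanSpace ℝ (Fin (2 * N)) →
      EuclideanSpace ℝ (Fin (N + 1)) × EuclideanSpace ℝ (Fin (N + 1)))
    (hC : C = fun u => ((Real.sqrt 2)⁻¹ • X u, (Real.sqrt 2)⁻¹ • Y u))
    (hD : D = fun u => ((Real.sqrt 2)⁻¹ • X u, -((Real.sqrt 2)⁻¹ • Y u)))
    (g : EuclideanSpace ℝ (Fin (2 * N)) → Matrix (Fin (2 * N)) (Fin (2 * N)) ℝ)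
    (hg : ∀ u i j, g u i j = dot (pd i C u) (pd j C u))
    (w : Fin (2 * N) → EuclideanSpace ℝ (Fin (2 * N)) → ℝ)
    (hw : ∀ j u, w j u = dot (pd j C u) (Jmap (C u)))
    (U : Set (EuclideanSpace ℝ (Fin (2 * N)))) (hUopen : IsOpen U)
    (hginv : ∀ u ∈ U, IsUnit (g u).det) :
    ∀ u ∈ U,
      1 - dot (D u) (Jmap (C u)) ^ 2 = ∑ i, ∑ j, (g u)⁻¹ i j * w i u * w j u := by
  intro u hu
  have hXd : Differentiable ℝ X := hX.differentiable (by simp)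
  have hYd : Differentiable ℝ Y := hY.differentiable (by simp)
  have hpd (i) : pd i C u = ((Real.sqrt 2)⁻¹ • pd i X u, (Real.sqrt 2)⁻¹ • pd i Y u) := by
    rw [hC]
    have h := ((hXd u).hasFDerivAt.const_smul (Real.sqrt 2)⁻¹).prodMk
      ((hYd u).hasFDerivAt.const_smul (Real.sqrt 2)⁻¹)
    exact congrArg (fun L => L (EuclideanSpace.single i 1)) h.fderiv
  have hXi (i) := inner_pd_eq_zero_of_norm_eq_one hXd hXnorm i u
  have hYi (i) := inner_pd_eq_zero_of_norm_eq_one hYd hYnorm i u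
  have hs : (Real.sqrt 2)⁻¹ * (Real.sqrt 2)⁻¹ = 1 / 2 := by
    rw [← mul_inv, Real.mul_self_sqrt (by norm_num)]
    norm_num
  have hdot (p q : EuclideanSpace ℝ (Fin (N + 1)) × EuclideanSpace ℝ (Fin (N + 1))) :
      ⟪WithLp.toLp 2 p, WithLp.toLp 2 q⟫ = dot p q := by
    simp [dot, WithLp.prod_inner_apply]
  have hXX : ⟪X u, X u⟫ = 1 := by simp [hXnorm]
  have hYY : ⟪Y u, Y u⟫ = 1 := by simp [hYnorm]
  have key := inner_self_eq_of_gram_isUnit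
    (E := WithLp 2 (EuclideanSpace ℝ (Fin (N + 1)) × EuclideanSpace ℝ (Fin (N + 1))))
    (by
      rw [(WithLp.linearEquiv 2 ℝ _).finrank_eq]
      simp
      ring)
    (fun i => WithLp.toLp 2 (pd i C u)) (WithLp.toLp 2 (C u)) (WithLp.toLp 2 (D u)) (g u)
    (fun i j => by rw [hdot, hg]) (hginv u hu)
    (by
      simp only [hdot, dot, hC, real_inner_smul_left, real_inner_smul_right, hXX, hYY]
      linarith)
    (by
      simp only [hdot, dot, hD, inner_neg_neg, real_inner_smul_left, real_inner_smul_right,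
        hXX, hYY]
      linarith)
    (by
      simp only [hdot, dot, hC, hD, inner_neg_right, real_inner_smul_left, real_inner_smul_right,
        hXX, hYY]
      ring)
    (fun i => by
      rw [hdot, hpd]
      simp [dot, hC, real_inner_smul_left, real_inner_smul_right, hXi, hYi])
    (fun i => by
      rw [hdot, hpd]
      simp [dot, hD, real_inner_smul_left, real_inner_smul_right, hXi, hYi])
    (WithLp.toLp 2 (Jmap (C u)))
  simp only [hdot, ← hw] at key
  have hJJ : dot (Jmap (C u)) (Jmap (C u)) = 1 := by
    simp only [dot, Jmap, hC, inner_neg_neg, real_inner_smul_left, real_inner_smul_right, hXX, hYY]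
    linarith
  have hCJ : dot (C u) (Jmap (C u)) = 0 := by
    simp only [dot, Jmap, inner_neg_right]
    rw [real_inner_comm]
    ring
  rw [hJJ, hCJ] at key
  linarith
end

section
/- On U the divergence-type identity Σ_{i,j=1}^{2N} ∂/∂u_i ( √g · g^{ij} w_j ) = 0 holds. (Lemma 2.2(c).) -/
open scoped RealInnerProductSpace BigOperators

section MatrixCalculus

variable {n E : Type*} [Fintype n] [DecidableEq n] [NormedAddCommGroup E] [NormedSpace ℝ E]

/-- Jacobi's formula for the derivative of a determinant. -/
theorem hasFDerivAt_det {M : E → Matrix n n ℝ} {M' : n → n → E →L[ℝ] ℝ} {u : E}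
    (hM : ∀ i j, HasFDerivAt (fun v => M v i j) (M' i j) u) :
    HasFDerivAt (fun v => (M v).det) (∑ i, ∑ j, (M u).adjugate i j • M' j i) u := by
  have hprod : HasFDerivAt (fun v => (M v).det)
      (∑ σ : Equiv.Perm n, (Equiv.Perm.sign σ : ℤ) •
        ∑ i, (∏ j ∈ Finset.univ.erase i, M u (σ j) j) • M' (σ i) i) u := by
    simp only [Matrix.det_apply]
    refine HasFDerivAt.fun_sum fun σ _ => ?_
    have h := (HasFDerivAt.finsetProd (u := Finset.univ) fun i _ => hM (σ i) i).const_smul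
      ((Equiv.Perm.sign σ : ℤ) : ℝ)
    simp only [Int.cast_smul_eq_zsmul] at h
    exact h
  refine hprod.congr_fderiv ?_
  ext e
  have hcol (i : n) : ∑ j, (M u).adjugate i j * M' j i e
      = ((M u).updateCol i fun j => M' j i e).det := by
    rw [← Matrix.cramer_apply, Matrix.cramer_eq_adjugate_mulVec]
    rfl
  simp only [sum_apply, smul_apply, smul_eq_mul, hcol, Matrix.det_apply, Finset.smul_sum]
  rw [Finset.sum_comm]
  refine Finset.sum_congr rfl fun i _ => Finset.sum_congr rfl fun σ _ => ?_
  rw [← Finset.mul_prod_erase _ _ (Finset.mem_univ i), Matrix.updateCol_self, mul_comm]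
  rw [Units.smul_def]
  congr 2
  refine Finset.prod_congr rfl fun j hj => ?_
  rw [Matrix.updateCol_ne (Finset.ne_of_mem_erase hj)]

theorem differentiableAt_det {M : E → Matrix n n ℝ} {u : E}
    (hM : ∀ i j, DifferentiableAt ℝ (fun v => M v i j) u) :
    DifferentiableAt ℝ (fun v => (M v).det) u :=
  (hasFDerivAt_det fun i j => (hM i j).hasFDerivAt).differentiableAt

theorem differentiableAt_matrix_inv_apply {M : E → Matrix n n ℝ} {u : E}
    (hM : ∀ i j, DifferentiableAt ℝ (fun v => M v i j) u) (hu : (M u).det ≠ 0) (i j : n) :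
    DifferentiableAt ℝ (fun v => (M v)⁻¹ i j) u := by
  have hadj : DifferentiableAt ℝ (fun v => (M v).adjugate i j) u := by
    simp only [Matrix.adjugate_apply]
    refine differentiableAt_det fun k l => ?_
    by_cases hk : k = j
    · subst hk
      simp
    · simpa [Matrix.updateRow_ne hk] using hM k l
  simp only [Matrix.inv_def, Ring.inverse_eq_inv', Matrix.smul_apply, smul_eq_mul]
  exact ((differentiableAt_det hM).inv hu).mul hadj

theorem fderiv_sqrt_det {M : E → Matrix n n ℝ} {u : E}
    (hM : ∀ i j, DifferentiableAt ℝ (fun v => M v i j) u) (hu : (M u).det ≠ 0) (e : E) :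
    fderiv ℝ (fun v => √(M v).det) u e =
      √(M u).det / 2 * ∑ i, ∑ j, (M u)⁻¹ i j * fderiv ℝ (fun v => M v j i) u e := by
  rw [fderiv_sqrt (differentiableAt_det hM) hu,
    (hasFDerivAt_det fun i j => (hM i j).hasFDerivAt).fderiv]
  simp only [sum_apply, smul_apply, smul_eq_mul, Matrix.inv_def, Ring.inverse_eq_inv',
    Matrix.smul_apply, mul_assoc, ← Finset.mul_sum]
  rw [← mul_assoc]
  congr 1
  nth_rewrite 2 [← Real.div_sqrt]
  by_cases hs : √(M u).det = 0
  · simp [hs]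
  · field_simp

theorem sum_fderiv_inv_mul {M : E → Matrix n n ℝ} {u : E}
    (hM : ∀ i j, DifferentiableAt ℝ (fun v => M v i j) u) (hu : (M u).det ≠ 0) (e : E)
    (i k : n) :
    ∑ j, fderiv ℝ (fun v => (M v)⁻¹ i j) u e * M u j k =
      -∑ j, (M u)⁻¹ i j * fderiv ℝ (fun v => M v j k) u e := by
  have hinv := differentiableAt_matrix_inv_apply hM hu
  have hd : HasFDerivAt (fun v => ∑ j, (M v)⁻¹ i j * M v j k)
      (∑ j, ((M u)⁻¹ i j • fderiv ℝ (fun v => M v j k) u +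
        M u j k • fderiv ℝ (fun v => (M v)⁻¹ i j) u)) u :=
    HasFDerivAt.fun_sum fun j _ => (hinv i j).hasFDerivAt.mul (hM j k).hasFDerivAt
  have hconst : (fun v => ∑ j, (M v)⁻¹ i j * M v j k) =ᶠ[nhds u]
      fun _ => (1 : Matrix n n ℝ) i k := by
    filter_upwards [(differentiableAt_det hM).continuousAt.eventually_ne hu] with v hv
    rw [← Matrix.nonsing_inv_mul (M v) (isUnit_iff_ne_zero.2 hv), Matrix.mul_apply]
  have h0 := hd.unique ((hasFDerivAt_const _ u).congr_of_eventuallyEq hconst)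
  have h1 := congrArg (fun L : E →L[ℝ] ℝ => L e) h0
  simp only [sum_apply, add_apply, smul_apply, smul_eq_mul, Finset.sum_add_distrib,
    zero_apply] at h1
  simp only [mul_comm (fderiv ℝ _ u e) (M u _ _)]
  linarith

end MatrixCalculus

section Dot

variable {m : ℕ}

local notation "V" => EuclideanSpace ℝ (Fin m) × EuclideanSpace ℝ (Fin m)

/-- The dot product as a bilinear map. -/
noncomputable def dotBilin (m : ℕ) :
    (EuclideanSpace ℝ (Fin m) × EuclideanSpace ℝ (Fin m)) →ₗ[ℝ]
      (EuclideanSpace ℝ (Fin m) × EuclideanSpace ℝ (Fin m)) →ₗ[ℝ] ℝ :=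
  LinearMap.mk₂ ℝ dot
    (fun p p' q => by simp only [dot, Prod.fst_add, Prod.snd_add, inner_add_left]; ring)
    (fun c p q => by
      simp only [dot, Prod.smul_fst, Prod.smul_snd, real_inner_smul_left, smul_eq_mul]
      ring)
    (fun p q q' => by simp only [dot, Prod.fst_add, Prod.snd_add, inner_add_right]; ring)
    (fun c p q => by
      simp only [dot, Prod.smul_fst, Prod.smul_snd, real_inner_smul_right, smul_eq_mul]
      ring)

theorem dotBilin_apply (p q : V) : dotBilin m p q = dot p q := rfl

theorem dot_comm (p q : V) : dot p q = dot q p := by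
  simp only [dot, real_inner_comm]

theorem dot_Jmap_right (p q : V) : dot p (Jmap q) = -dot q (Jmap p) := by
  simp only [dot, Jmap, inner_neg_right, real_inner_comm]
  ring

theorem dot_self_Jmap (p : V) : dot p (Jmap p) = 0 := by
  linarith [dot_Jmap_right p p]

/-- If `a` has nondegenerate Gram matrix, `c` and `d` are orthonormal and orthogonal to `a`, and
together they have as many members as the dimension, then they separate vectors. -/
theorem eq_zero_of_dot_eq_zero {ι : Type*} [Fintype ι] [DecidableEq ι]
    (hcard : Fintype.card ι + 2 = m + m) (a : ι → V) (c d : V)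
    (hgram : IsUnit (Matrix.of fun i j => dot (a i) (a j)).det)
    (hac : ∀ i, dot (a i) c = 0) (had : ∀ i, dot (a i) d = 0)
    (hcc : dot c c = 1) (hdd : dot d d = 1) (hcd : dot c d = 0)
    (p : V) (hpa : ∀ i, dot (a i) p = 0) (hpc : dot c p = 0) (hpd : dot d p = 0) : p = 0 := by
  let L : V →ₗ[ℝ] (ι → ℝ) × ℝ × ℝ :=
    (LinearMap.pi fun i => dotBilin m (a i)).prod ((dotBilin m c).prod (dotBilin m d))
  have hL (q : V) : L q = (fun i => dot (a i) q, dot c q, dot d q) := rfl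
  have hfin : Module.finrank ℝ V = Module.finrank ℝ ((ι → ℝ) × ℝ × ℝ) := by
    simp [Module.finrank_prod, ← hcard]
  have hsurj : Function.Surjective L := by
    rintro ⟨x, y, z⟩
    set G : Matrix ι ι ℝ := Matrix.of fun i j => dot (a i) (a j) with hG
    refine ⟨∑ j, (G⁻¹.mulVec x) j • a j + y • c + z • d, ?_⟩
    have hx : G.mulVec (G⁻¹.mulVec x) = x := by
      rw [Matrix.mulVec_mulVec, Matrix.mul_nonsing_inv _ hgram, Matrix.one_mulVec]
    have hca (i) : dot c (a i) = 0 := by rw [dot_comm, hac]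
    have hda (i) : dot d (a i) = 0 := by rw [dot_comm, had]
    have hdc : dot d c = 0 := by rw [dot_comm, hcd]
    rw [hL]
    simp only [← dotBilin_apply, map_add, map_sum, map_smul, smul_eq_mul]
    simp only [dotBilin_apply, hac, had, hcc, hdd, hcd, hca, hda, hdc]
    ext i
    · conv_rhs => rw [← hx]
      simp [Matrix.mulVec, dotProduct, hG, mul_comm]
    · simp
    · simp
  have hinj := (LinearMap.injective_iff_surjective_of_finrank_eq_finrank hfin).2 hsurj
  refine hinj ?_
  rw [map_zero, hL, hpc, hpd]
  simp only [hpa]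
  rfl

theorem differentiableAt_dot {E : Type*} [NormedAddCommGroup E] [NormedSpace ℝ E]
    {f h : E → V} {u : E} (hf : DifferentiableAt ℝ f u) (hh : DifferentiableAt ℝ h u) :
    DifferentiableAt ℝ (fun v => dot (f v) (h v)) u := by
  unfold dot
  exact (hf.fst.inner ℝ hh.fst).add (hf.snd.inner ℝ hh.snd)

theorem fderiv_dot {E : Type*} [NormedAddCommGroup E] [NormedSpace ℝ E]
    {f h : E → V} {u : E} (hf : DifferentiableAt ℝ f u) (hh : DifferentiableAt ℝ h u) (e : E) :
    fderiv ℝ (fun v => dot (f v) (h v)) u e =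
      dot (fderiv ℝ f u e) (h u) + dot (f u) (fderiv ℝ h u e) := by
  unfold dot
  rw [fderiv_fun_add (hf.fst.inner ℝ hh.fst) (hf.snd.inner ℝ hh.snd), add_apply,
    fderiv_inner_apply ℝ hf.fst hh.fst, fderiv_inner_apply ℝ hf.snd hh.snd,
    fderiv.fst hf, fderiv.fst hh, fderiv.snd hf, fderiv.snd hh]
  simp only [ContinuousLinearMap.comp_apply, ContinuousLinearMap.coe_fst',
    ContinuousLinearMap.coe_snd']
  ring

theorem differentiableAt_Jmap {E : Type*} [NormedAddCommGroup E] [NormedSpace ℝ E]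
    {f : E → V} {u : E} (hf : DifferentiableAt ℝ f u) :
    DifferentiableAt ℝ (fun v => Jmap (f v)) u :=
  hf.snd.neg.prodMk hf.fst

theorem fderiv_Jmap {E : Type*} [NormedAddCommGroup E] [NormedSpace ℝ E]
    {f : E → V} {u : E} (hf : DifferentiableAt ℝ f u) (e : E) :
    fderiv ℝ (fun v => Jmap (f v)) u e = Jmap (fderiv ℝ f u e) := by
  have h : HasFDerivAt (fun v => Jmap (f v)) _ u :=
    hf.hasFDerivAt.snd.neg.prodMk hf.hasFDerivAt.fst
  rw [h.fderiv]
  rfl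

end Dot

section Divergence

variable {m : ℕ} {ι : Type*} [Fintype ι] [DecidableEq ι]

theorem pd_pd_comm {F : Type*} [NormedAddCommGroup F] [NormedSpace ℝ F]
    {f : EuclideanSpace ℝ ι → F} (hf : ContDiff ℝ 2 f) (i j : ι) (u : EuclideanSpace ℝ ι) :
    pd i (pd j f) u = pd j (pd i f) u := by
  have hd : DifferentiableAt ℝ (fderiv ℝ f) u :=
    (hf.fderiv_right (m := 1) (by norm_num)).differentiable (by norm_num) u
  have key (k l : ι) : pd k (pd l f) u =
      fderiv ℝ (fderiv ℝ f) u (EuclideanSpace.single k 1) (EuclideanSpace.single l 1) := by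
    change fderiv ℝ (fun v => fderiv ℝ f v (EuclideanSpace.single l 1)) u _ = _
    rw [fderiv_clm_apply hd (differentiableAt_const _)]
    simp
  rw [key, key]
  exact (hf.contDiffAt.isSymmSndFDerivAt (by simp)).eq _ _

theorem differentiable_pd {F : Type*} [NormedAddCommGroup F] [NormedSpace ℝ F]
    {f : EuclideanSpace ℝ ι → F} (hf : ContDiff ℝ 2 f) (i : ι) : Differentiable ℝ (pd i f) := by
  have hd : Differentiable ℝ (fderiv ℝ f) :=
    (hf.fderiv_right (m := 1) (by norm_num)).differentiable (by norm_num)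
  exact fun u => (hd u).clm_apply (differentiableAt_const _)

theorem pd_mul {f h : EuclideanSpace ℝ ι → ℝ} {i : ι} {u : EuclideanSpace ℝ ι}
    (hf : DifferentiableAt ℝ f u) (hh : DifferentiableAt ℝ h u) :
    pd i (fun v => f v * h v) u = pd i f u * h u + f u * pd i h u := by
  unfold pd
  rw [fderiv_fun_mul hf hh]
  simp only [add_apply, smul_apply, smul_eq_mul]
  ring

/-- If the partial derivatives in the `i`-th direction satisfy `∂ᵢ D = εᵢ ∂ᵢ C` with
`∑ εᵢ = 0`, the divergence of the tangential part of `JC` vanishes. -/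
theorem sum_pd_sqrt_det_mul_inv_mul_dot_Jmap_eq_zero (hcard : Fintype.card ι + 2 = m + m)
    {C D : EuclideanSpace ℝ ι → EuclideanSpace ℝ (Fin m) × EuclideanSpace ℝ (Fin m)}
    (hC : ContDiff ℝ 2 C) (hD : Differentiable ℝ D)
    (hCC : ∀ v, dot (C v) (C v) = 1) (hDD : ∀ v, dot (D v) (D v) = 1)
    (hCD : ∀ v, dot (C v) (D v) = 0) (ε : ι → ℝ) (hε : ∑ i, ε i = 0)
    (hDC : ∀ i v, pd i D v = ε i • pd i C v)
    {g : EuclideanSpace ℝ ι → Matrix ι ι ℝ}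
    (hg : ∀ v i j, g v i j = dot (pd i C v) (pd j C v))
    {u : EuclideanSpace ℝ ι} (hu : (g u).det ≠ 0) :
    ∑ i, ∑ j, pd i (fun v => √(g v).det * (g v)⁻¹ i j * dot (pd j C v) (Jmap (C v))) u = 0 := by
  have hCd : Differentiable ℝ C := hC.differentiable (by norm_num)
  have hC1 := differentiable_pd hC
  have hac (v i) : dot (pd i C v) (C v) = 0 := by
    have h := fderiv_dot (hCd v) (hCd v) (EuclideanSpace.single i 1)
    simp only [hCC, fderiv_fun_const, Pi.zero_apply, zero_apply] at h
    change 0 = dot (pd i C v) (C v) + dot (C v) (pd i C v) at h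
    linarith [dot_comm (C v) (pd i C v)]
  have had (v i) : dot (pd i C v) (D v) = 0 := by
    have h := fderiv_dot (hCd v) (hD v) (EuclideanSpace.single i 1)
    simp only [hCD, fderiv_fun_const, Pi.zero_apply, zero_apply] at h
    change 0 = dot (pd i C v) (D v) + dot (C v) (pd i D v) at h
    rw [hDC, dot_comm (C v), ← dotBilin_apply (_ • _), map_smul, LinearMap.smul_apply,
      dotBilin_apply, hac] at h
    simpa using h.symm
  have hgd (i j) : DifferentiableAt ℝ (fun v => g v i j) u := by
    simp only [hg]
    exact differentiableAt_dot (hC1 i u) (hC1 j u)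
  have hsd : DifferentiableAt ℝ (fun v => √(g v).det) u := (differentiableAt_det hgd).sqrt hu
  have hid (i j) : DifferentiableAt ℝ (fun v => (g v)⁻¹ i j) u :=
    differentiableAt_matrix_inv_apply hgd hu i j
  have hsymm : (g u).IsSymm := Matrix.IsSymm.ext fun i j => by rw [hg, hg, dot_comm]
  have hHsymm (i j) : (g u)⁻¹ i j = (g u)⁻¹ j i := by
    conv_lhs => rw [← hsymm.inv.eq]
    rfl
  have hHg (i k) : ∑ j, (g u)⁻¹ i j * g u j k = if i = k then 1 else 0 := by
    rw [← Matrix.mul_apply, Matrix.nonsing_inv_mul _ (isUnit_iff_ne_zero.2 hu), Matrix.one_apply]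
  have hdg (k i j) : pd k (fun v => g v i j) u =
      dot (pd k (pd i C) u) (pd j C u) + dot (pd i C u) (pd k (pd j C) u) := by
    simp only [hg]
    exact fderiv_dot (hC1 i u) (hC1 j u) _
  have hdS (k) := fderiv_sqrt_det hgd hu (EuclideanSpace.single k 1)
  have hdH (i k) := sum_fderiv_inv_mul hgd hu (EuclideanSpace.single i 1) i k
  change ∀ k, pd k (fun v => √(g v).det) u = _ * ∑ i, ∑ j, _ * pd k (fun v => g v j i) u at hdS
  change ∀ i k, ∑ j, pd i (fun v => (g v)⁻¹ i j) u * _ =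
    -∑ j, _ * pd i (fun v => g v j k) u at hdH
  have hdw (i j) : pd i (fun v => √(g v).det * (g v)⁻¹ i j * dot (pd j C v) (Jmap (C v))) u =
      (pd i (fun v => √(g v).det) u * (g u)⁻¹ i j +
        √(g u).det * pd i (fun v => (g v)⁻¹ i j) u) * dot (pd j C u) (Jmap (C u)) +
      √(g u).det * (g u)⁻¹ i j *
        (dot (pd i (pd j C) u) (Jmap (C u)) + dot (pd j C u) (Jmap (pd i C u))) := by
    have hJ := fderiv_dot (hC1 j u) (differentiableAt_Jmap (hCd u)) (EuclideanSpace.single i 1)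
    rw [fderiv_Jmap (hCd u)] at hJ
    change pd i (fun v => dot (pd j C v) (Jmap (C v))) u =
      dot (pd i (pd j C) u) (Jmap (C u)) + dot (pd j C u) (Jmap (pd i C u)) at hJ
    rw [pd_mul (hsd.fun_mul (hid i j))
      (differentiableAt_dot (hC1 j u) (differentiableAt_Jmap (hCd u))), pd_mul hsd (hid i j), hJ]
  simp only [hdw]
  have hdS' (k) : pd k (fun v => √(g v).det) u =
      √(g u).det * ∑ i, ∑ j, (g u)⁻¹ i j * dot (pd j C u) (pd i (pd k C) u) := by
    rw [hdS]
    simp only [hdg, mul_add, Finset.sum_add_distrib]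
    have h1 : ∑ i, ∑ j, (g u)⁻¹ i j * dot (pd k (pd j C) u) (pd i C u) =
        ∑ i, ∑ j, (g u)⁻¹ i j * dot (pd j C u) (pd k (pd i C) u) := by
      rw [Finset.sum_comm]
      exact Finset.sum_congr rfl fun i _ => Finset.sum_congr rfl fun j _ => by
        rw [hHsymm, dot_comm]
    rw [h1]
    simp only [pd_pd_comm hC k]
    ring
  obtain ⟨dS, hdS_eq⟩ : ∃ dS : ι → ℝ, ∀ k, pd k (fun v => √(g v).det) u = dS k :=
    ⟨_, fun _ => rfl⟩
  obtain ⟨dH, hdH_eq⟩ : ∃ dH : ι → ι → ℝ, ∀ i j, pd i (fun v => (g v)⁻¹ i j) u = dH i j :=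
    ⟨_, fun _ _ => rfl⟩
  simp only [hdS_eq, hdH_eq] at hdS' hdH ⊢
  generalize √(g u).det = S at hdS' ⊢
  generalize (g u)⁻¹ = H at hHsymm hHg hdH hdS' ⊢
  set P := ∑ i, ∑ j, ((dS i * H i j + S * dH i j) • pd j C u + (S * H i j) • pd i (pd j C) u)
    with hP
  have hPdot (q) : dot P q = ∑ i, ∑ j, ((dS i * H i j + S * dH i j) * dot (pd j C u) q +
      S * H i j * dot (pd i (pd j C) u) q) := by
    rw [← dotBilin_apply, hP]
    simp only [map_add, map_sum, map_smul, smul_eq_mul, LinearMap.add_apply, LinearMap.sum_apply,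
      LinearMap.smul_apply, dotBilin_apply]
  have hPa (k) : dot P (pd k C u) = 0 := by
    rw [hPdot]
    have h1 (i) : ∑ j, ((dS i * H i j + S * dH i j) * dot (pd j C u) (pd k C u) +
        S * H i j * dot (pd i (pd j C) u) (pd k C u)) =
        dS i * (if i = k then 1 else 0) -
          S * ∑ j, H i j * dot (pd j C u) (pd i (pd k C) u) := by
      have h2 : ∑ j, H i j * pd i (fun v => g v j k) u =
          ∑ j, H i j * dot (pd i (pd j C) u) (pd k C u) +
            ∑ j, H i j * dot (pd j C u) (pd i (pd k C) u) := by
        simp only [hdg, mul_add, Finset.sum_add_distrib]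
      have h3 := hdH i k
      rw [h2] at h3
      simp only [← hg, add_mul, Finset.sum_add_distrib, mul_assoc, ← Finset.mul_sum, hHg, h3]
      ring
    rw [Finset.sum_congr rfl fun i _ => h1 i, Finset.sum_sub_distrib, ← Finset.mul_sum, ← hdS']
    simp
  have hPD : dot P (D u) = 0 := by
    rw [hPdot]
    have hbd (i j) : dot (pd i (pd j C) u) (D u) = -(ε i * g u j i) := by
      have h := fderiv_dot (hC1 j u) (hD u) (EuclideanSpace.single i 1)
      simp only [had, fderiv_fun_const, Pi.zero_apply, zero_apply] at h
      change 0 = dot (pd i (pd j C) u) (D u) + dot (pd j C u) (pd i D u) at h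
      rw [hDC, ← dotBilin_apply _ (_ • _), map_smul, dotBilin_apply, smul_eq_mul, ← hg] at h
      linarith
    simp only [had, hbd, mul_zero, zero_add]
    have h1 (i) : ∑ j, S * H i j * -(ε i * g u j i) = -(S * ε i) := by
      calc _ = -(S * ε i) * ∑ j, H i j * g u j i := by
            rw [Finset.mul_sum]
            exact Finset.sum_congr rfl fun j _ => by ring
        _ = _ := by rw [hHg]; simp
    simp only [h1, Finset.sum_neg_distrib, ← Finset.mul_sum, hε, mul_zero, neg_zero]
  have hPC : P - dot P (C u) • C u = 0 := by
    have hsub (q) : dot q (P - dot P (C u) • C u) = dot P q - dot P (C u) * dot q (C u) := by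
      rw [← dotBilin_apply, map_sub, map_smul, dotBilin_apply, dotBilin_apply, dot_comm q P,
        smul_eq_mul]
    refine eq_zero_of_dot_eq_zero hcard (fun i => pd i C u) (C u) (D u) ?_ (hac u) (had u)
      (hCC u) (hDD u) (hCD u) _ (fun i => ?_) ?_ ?_
    · rw [show (Matrix.of fun i j => dot (pd i C u) (pd j C u)) = g u from
        Matrix.ext fun i j => (hg u i j).symm]
      exact isUnit_iff_ne_zero.2 hu
    · rw [hsub, hPa, hac]
      ring
    · rw [hsub, hCC]
      ring
    · rw [hsub, hPD, dot_comm (D u), hCD]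
      ring
  have hPJ : dot P (Jmap (C u)) = 0 := by
    rw [sub_eq_zero.1 hPC, ← dotBilin_apply, map_smul, LinearMap.smul_apply, dotBilin_apply,
      dot_self_Jmap, smul_zero]
  have hanti : ∑ i, ∑ j, S * H i j * dot (pd j C u) (Jmap (pd i C u)) = 0 := by
    have h : ∑ i, ∑ j, S * H i j * dot (pd j C u) (Jmap (pd i C u)) =
        -∑ i, ∑ j, S * H i j * dot (pd j C u) (Jmap (pd i C u)) := by
      conv_lhs => rw [Finset.sum_comm]
      simp only [← Finset.sum_neg_distrib]
      refine Finset.sum_congr rfl fun i _ => Finset.sum_congr rfl fun j _ => ?_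
      rw [hHsymm, dot_Jmap_right]
      ring
    linarith
  rw [hPdot] at hPJ
  simp only [mul_add (S * _), ← add_assoc]
  simp only [Finset.sum_add_distrib] at hPJ hanti ⊢
  linarith

end Divergence

theorem pd_eq_zero_of_eq_along {ι F : Type*} [Fintype ι] [DecidableEq ι]
    [NormedAddCommGroup F] [NormedSpace ℝ F] {f : EuclideanSpace ℝ ι → F}
    (hf : Differentiable ℝ f) (i : ι) (u : EuclideanSpace ℝ ι)
    (h : ∀ t : ℝ, f (u + t • EuclideanSpace.single i 1) = f u) : pd i f u = 0 := by
  unfold pd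
  rw [← (hf u).lineDeriv_eq_fderiv, lineDeriv]
  simp [h]

theorem sum_ite_lt_one_neg_one (N : ℕ) :
    ∑ i : Fin (2 * N), (if (i : ℕ) < N then (1 : ℝ) else -1) = 0 := by
  rw [Fin.sum_univ_eq_sum_range fun i => if i < N then (1 : ℝ) else -1, two_mul,
    Finset.sum_range_add]
  rw [Finset.sum_congr rfl fun i hi => if_pos (Finset.mem_range.1 hi)]
  simp

/-- Lemma 2.2(c): divergence-type identity. -/
theorem clifford_torus_divergence_identity (N : ℕ) (hN : 1 ≤ N)
    (X Y : EuclideanSpace ℝ (Fin (2 * N)) → EuclideanSpace ℝ (Fin (N + 1)))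
    (hX : ContDiff ℝ (⊤ : ℕ∞) X) (hY : ContDiff ℝ (⊤ : ℕ∞) Y)
    (hXdep : ∀ u u' : EuclideanSpace ℝ (Fin (2 * N)),
      (∀ i : Fin (2 * N), (i : ℕ) < N → u i = u' i) → X u = X u')
    (hYdep : ∀ u u' : EuclideanSpace ℝ (Fin (2 * N)),
      (∀ i : Fin (2 * N), N ≤ (i : ℕ) → u i = u' i) → Y u = Y u')
    (hXnorm : ∀ u, ‖X u‖ = 1) (hYnorm : ∀ u, ‖Y u‖ = 1)
    (C D : EuclideanSpace ℝ (Fin (2 * N)) →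
      EuclideanSpace ℝ (Fin (N + 1)) × EuclideanSpace ℝ (Fin (N + 1)))
    (hC : C = fun u => ((Real.sqrt 2)⁻¹ • X u, (Real.sqrt 2)⁻¹ • Y u))
    (hD : D = fun u => ((Real.sqrt 2)⁻¹ • X u, -((Real.sqrt 2)⁻¹ • Y u)))
    (g : EuclideanSpace ℝ (Fin (2 * N)) → Matrix (Fin (2 * N)) (Fin (2 * N)) ℝ)
    (hg : ∀ u i j, g u i j = dot (pd i C u) (pd j C u))
    (w : Fin (2 * N) → EuclideanSpace ℝ (Fin (2 * N)) → ℝ)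
    (hw : ∀ j u, w j u = dot (pd j C u) (Jmap (C u)))
    (U : Set (EuclideanSpace ℝ (Fin (2 * N)))) (hUopen : IsOpen U)
    (hginv : ∀ u ∈ U, IsUnit (g u).det) :
    ∀ u ∈ U,
      ∑ i, ∑ j, pd i (fun v => Real.sqrt (g v).det * (g v)⁻¹ i j * w j v) u = 0 := by
  intro u hu
  have hXd : Differentiable ℝ X := hX.differentiable (by simp)
  have hYd : Differentiable ℝ Y := hY.differentiable (by simp)
  have hsq : (√2 : ℝ)⁻¹ * (√2)⁻¹ = 1 / 2 := by
    rw [← mul_inv, Real.mul_self_sqrt (by norm_num)]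
    norm_num
  have hXX (v) : @inner ℝ _ _ (X v) (X v) = 1 := by simp [hXnorm]
  have hYY (v) : @inner ℝ _ _ (Y v) (Y v) = 1 := by simp [hYnorm]
  have hXpd (i : Fin (2 * N)) (hi : ¬ (i : ℕ) < N) (v) : pd i X v = 0 :=
    pd_eq_zero_of_eq_along hXd i v fun t => hXdep _ _ fun j hj => by
      have hji : j ≠ i := fun h => hi (h ▸ hj)
      simp [hji]
  have hYpd (i : Fin (2 * N)) (hi : (i : ℕ) < N) (v) : pd i Y v = 0 :=
    pd_eq_zero_of_eq_along hYd i v fun t => hYdep _ _ fun j hj => by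
      have hji : j ≠ i := fun h => absurd hi (not_lt.2 (h ▸ hj))
      simp [hji]
  have hpdC (i v) : pd i C v = ((√2)⁻¹ • pd i X v, (√2)⁻¹ • pd i Y v) := by
    have h : HasFDerivAt C _ v := hC ▸
      ((hXd v).hasFDerivAt.const_smul (√2 : ℝ)⁻¹).prodMk
        ((hYd v).hasFDerivAt.const_smul (√2 : ℝ)⁻¹)
    unfold pd
    rw [h.fderiv]
    rfl
  have hDd (v) : HasFDerivAt D _ v := hD ▸
    ((hXd v).hasFDerivAt.const_smul (√2 : ℝ)⁻¹).prodMk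
      ((hYd v).hasFDerivAt.const_smul (√2 : ℝ)⁻¹).fun_neg
  have hpdD (i v) : pd i D v = ((√2)⁻¹ • pd i X v, -((√2)⁻¹ • pd i Y v)) := by
    unfold pd
    rw [(hDd v).fderiv]
    rfl
  have hC2 : ContDiff ℝ 2 C := by
    have h2 : (2 : WithTop ℕ∞) ≤ ((⊤ : ℕ∞) : WithTop ℕ∞) :=
      WithTop.coe_le_coe.2 (le_top : (2 : ℕ∞) ≤ ⊤)
    rw [hC]
    exact ((hX.of_le h2).const_smul _).prodMk ((hY.of_le h2).const_smul _)
  have key := sum_pd_sqrt_det_mul_inv_mul_dot_Jmap_eq_zero (C := C) (D := D) (g := g) (u := u)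
    (by simp; ring) hC2 (fun v => (hDd v).differentiableAt) ?_ ?_ ?_
    (fun i : Fin (2 * N) => if (i : ℕ) < N then (1 : ℝ) else -1) (sum_ite_lt_one_neg_one N)
    ?_ hg (hginv u hu).ne_zero
  · simp only [hw]
    exact key
  · intro v
    simp only [hC, dot, real_inner_smul_left, real_inner_smul_right, hXX, hYY]
    linarith
  · intro v
    simp only [hD, dot, real_inner_smul_left, real_inner_smul_right, hXX, hYY, inner_neg_left,
      inner_neg_right]
    linarith
  · intro v
    simp only [hC, hD, dot, real_inner_smul_left, real_inner_smul_right, hXX, hYY,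
      inner_neg_right]
    linarith
  · intro i v
    rw [hpdC, hpdD]
    by_cases hi : (i : ℕ) < N
    · simp [hi, hYpd i hi]
    · simp [hi, hXpd i hi]
end
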